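/- Let (x̄,ū,v̄)∈M_φ(0) where M_φ(Θ)={(x,u,v)∈ℝ^{n_x}×U×ℝ^{n_x} : φ(x,u,v)+Θ∈K_φ}, with φ:ℝ^{n_x}×ℝ^{n_u}×ℝ^{n_x}→ℝ^m Lipschitz continuous at (x̄,ū,v̄) and U, K_φ closed. Suppose the quasinormality condition holds at (x̄,ū,v̄): whenever λ∈N_{K_φ}(φ(x̄,ū,v̄)) satisfies (0,0,0)∈∂⟨λ,φ⟩(x̄,ū,v̄)+{0}×N_U(ū)×{0} and there exists a sequence (x^k,u^k,v^k,y^k,λ^k)→(x̄,ū,v̄,φ(x̄,ū,v̄),λ) with (x^k,u^k,v^k,y^k)∈ℝ^{n_x}×U×ℝ^{n_x}×K_φ and such that for each k and each i with λ_i≠0 one has λ_i(φ_i(x^k,u^k,v^k)−y_i^k)>0, then λ=0. Then M_φ is calm at (0,x̄,ū,v̄). -/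

import Mathlib

open Filter Topology Set MeasureTheory
open scoped RealInnerProductSpace ENNReal NNReal

noncomputable section

abbrev Euc (n : ℕ) : Type := EuclideanSpace ℝ (Fin n)

abbrev PL2 (α β : Type) : Type := WithLp 2 (α × β)

abbrev PL3 (α β γ : Type) : Type := PL2 α (PL2 β γ)

def pl2 {α β : Type} (a : α) (b : β) : PL2 α β := (WithLp.equiv 2 (α × β)).symm (a, b)

def pl2fst {α β : Type} (z : PL2 α β) : α := (WithLp.equiv 2 (α × β) z).1

def pl2snd {α β : Type} (z : PL2 α β) : β := (WithLp.equiv 2 (α × β) z).2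

def pl3 {α β γ : Type} (a : α) (b : β) (c : γ) : PL3 α β γ := pl2 a (pl2 b c)

section Variational

variable {E : Type} [NormedAddCommGroup E] [InnerProductSpace ℝ E]

/-- Fréchet normal cone. -/
def frechetNC (C : Set E) (x : E) : Set E :=
  {v | ∀ ε > 0, ∃ δ > 0, ∀ y ∈ C, ‖y - x‖ < δ → ⟪v, y - x⟫ ≤ ε * ‖y - x‖}

/-- Limiting (Mordukhovich) normal cone. -/
def limitingNC (C : Set E) (x : E) : Set E :=
  {v | ∃ xs vs : ℕ → E, (∀ n, xs n ∈ C ∧ vs n ∈ frechetNC C (xs n)) ∧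
      Tendsto xs atTop (𝓝 x) ∧ Tendsto vs atTop (𝓝 v)}

/-- Clarke normal cone: closed convex hull of the limiting normal cone. -/
def clarkeNC (C : Set E) (x : E) : Set E := closure (convexHull ℝ (limitingNC C x))

def NormallyRegular (C : Set E) : Prop := ∀ x ∈ C, frechetNC C x = limitingNC C x

/-- Proximal subdifferential of a real-valued function. -/
def proxSubdiff (g : E → ℝ) (x : E) : Set E :=
  {ζ | ∃ σ > 0, ∃ δ > 0, ∀ y, ‖y - x‖ < δ →
    g x + ⟪ζ, y - x⟫ - σ * ‖y - x‖ ^ 2 ≤ g y}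

/-- Limiting (Mordukhovich) subdifferential. -/
def limSubdiff (g : E → ℝ) (x : E) : Set E :=
  {ζ | ∃ xs ζs : ℕ → E, (∀ n, ζs n ∈ proxSubdiff g (xs n)) ∧
      Tendsto xs atTop (𝓝 x) ∧ Tendsto (fun n => g (xs n)) atTop (𝓝 (g x)) ∧
      Tendsto ζs atTop (𝓝 ζ)}

/-- Clarke generalized gradient: convex hull of the limiting subdifferential. -/
def clarkeSubdiff (g : E → ℝ) (x : E) : Set E := convexHull ℝ (limSubdiff g x)

/-- Tangent (contingent) cone. -/
def tangentC (C : Set E) (x : E) : Set E :=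
  {w | ∃ (t : ℕ → ℝ) (ws : ℕ → E), (∀ n, 0 < t n ∧ x + t n • ws n ∈ C) ∧
      Tendsto t atTop (𝓝 0) ∧ Tendsto ws atTop (𝓝 w)}

/-- Directional limiting normal cone in direction `w`. -/
def dirLimitingNC (C : Set E) (x : E) (w : E) : Set E :=
  {v | ∃ (t : ℕ → ℝ) (ws vs : ℕ → E),
      (∀ n, 0 < t n ∧ vs n ∈ frechetNC C (x + t n • ws n)) ∧
      Tendsto t atTop (𝓝 0) ∧ Tendsto ws atTop (𝓝 w) ∧ Tendsto vs atTop (𝓝 v)}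

end Variational

section Maps

variable {F G : Type} [NormedAddCommGroup F] [NormedAddCommGroup G]

/-- Calmness of a set-valued map at a point of its graph (neighborhood-ball form). -/
def Calm (Ψ : F → Set G) (x₀ : F) (y₀ : G) : Prop :=
  ∃ μ : ℝ, 0 ≤ μ ∧ ∃ Ux ∈ 𝓝 x₀, ∃ Vy ∈ 𝓝 y₀,
    ∀ x ∈ Ux, ∀ y ∈ Ψ x ∩ Vy, ∃ z ∈ Ψ x₀, ‖y - z‖ ≤ μ * ‖x - x₀‖

/-- Upper Lipschitz continuity at a point. -/
def UpperLipschitzAt (Ψ : F → Set G) (x₀ : F) : Prop :=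
  ∃ μ : ℝ, 0 ≤ μ ∧ ∃ Ux ∈ 𝓝 x₀,
    ∀ x ∈ Ux, ∀ y ∈ Ψ x, ∃ z ∈ Ψ x₀, ‖y - z‖ ≤ μ * ‖x - x₀‖

end Maps

/-- An absolutely continuous arc on `[t0,t1]` with values in `ℝ^n`,
recorded together with its a.e. derivative. -/
structure Arc (n : ℕ) (t0 t1 : ℝ) where
  f : ℝ → Euc n
  d : ℝ → Euc n
  intble : IntervalIntegrable d volume t0 t1
  rel : ∀ t ∈ Set.Icc t0 t1, f t = f t0 + ∫ s in t0..t, d s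


namespace Stmt15

section Hilbert

variable {E : Type} [NormedAddCommGroup E] [InnerProductSpace ℝ E]

lemma norm_add_le_of_ne_zero {a : E} (ha : a ≠ 0) (h : E) :
    ‖a + h‖ ≤ ‖a‖ + ⟪‖a‖⁻¹ • a, h⟫ + ‖h‖ ^ 2 / (2 * ‖a‖) := by
  have hr : 0 < ‖a‖ := norm_pos_iff.2 ha
  rw [real_inner_smul_left]
  have h1 := norm_add_sq_real a h
  have h2 : 2 * ‖a‖ * ‖a + h‖ ≤ 2 * ‖a‖ ^ 2 + 2 * ⟪a, h⟫ + ‖h‖ ^ 2 := by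
    nlinarith [sq_nonneg (‖a‖ - ‖a + h‖)]
  have h3 : ‖a‖ + ‖a‖⁻¹ * ⟪a, h⟫ + ‖h‖ ^ 2 / (2 * ‖a‖)
      = (2 * ‖a‖ ^ 2 + 2 * ⟪a, h⟫ + ‖h‖ ^ 2) / (2 * ‖a‖) := by
    field_simp
  rw [h3, le_div_iff₀ (by positivity)]
  linarith

/-- A proximal normal is a Fréchet normal. -/
lemma mem_frechetNC_of_le_sq {C : Set E} {x v : E} {σ δ : ℝ} (hδ : 0 < δ)
    (h : ∀ y ∈ C, ‖y - x‖ < δ → ⟪v, y - x⟫ ≤ σ * ‖y - x‖ ^ 2) : v ∈ frechetNC C x := by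
  intro ε hε
  have hpos : 0 < |σ| + 1 := by positivity
  refine ⟨min δ (ε / (|σ| + 1)), by positivity, fun y hy hyx => ?_⟩
  have h1 := h y hy (hyx.trans_le (min_le_left _ _))
  have h2 : ‖y - x‖ < ε / (|σ| + 1) := hyx.trans_le (min_le_right _ _)
  rw [lt_div_iff₀ hpos] at h2
  have h3 : σ * ‖y - x‖ ≤ ε := by nlinarith [le_abs_self σ, norm_nonneg (y - x)]
  nlinarith [norm_nonneg (y - x)]

/-- The normalized residual of a nearest point is a Fréchet normal. -/
lemma smul_sub_mem_frechetNC_of_nearest {K : Set E} {a y : E}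
    (hy : ∀ y' ∈ K, ‖a - y‖ ≤ ‖a - y'‖) {t : ℝ} (ht : 0 ≤ t) :
    t • (a - y) ∈ frechetNC K y := by
  refine mem_frechetNC_of_le_sq (σ := t / 2) one_pos fun y' hy' _ => ?_
  have h1 := norm_sub_sq_real (a - y) (y' - y)
  have h2 : a - y - (y' - y) = a - y' := by abel
  rw [h2] at h1
  have h3 := pow_le_pow_left₀ (norm_nonneg _) (hy y' hy') 2
  rw [real_inner_smul_left]
  nlinarith

lemma norm_le_of_mem_proxSubdiff {g : E → ℝ} {x ζ : E} (hζ : ζ ∈ proxSubdiff g x)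
    {M δ : ℝ} (hδ : 0 < δ) (hg : ∀ y, ‖y - x‖ < δ → g y - g x ≤ M * ‖y - x‖) (hM : 0 ≤ M) :
    ‖ζ‖ ≤ M := by
  obtain ⟨σ, hσ, δ', hδ', h⟩ := hζ
  by_contra! hlt
  have hz : 0 < ‖ζ‖ := hM.trans_lt hlt
  set τ := min (min δ δ' / 2) ((‖ζ‖ - M) / (2 * σ)) with hτ
  have hτ0 : 0 < τ := by
    have : 0 < ‖ζ‖ - M := by linarith
    positivity
  have hm : 0 < min δ δ' := lt_min hδ hδ'
  have hτ1 : τ < min δ δ' := (min_le_left _ _).trans_lt (by linarith)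
  have hτ2 : τ * (2 * σ) ≤ ‖ζ‖ - M := by
    rw [← le_div_iff₀ (by positivity)]; exact min_le_right _ _
  have hn : ‖x + (τ / ‖ζ‖) • ζ - x‖ = τ := by
    rw [add_sub_cancel_left, norm_smul, Real.norm_of_nonneg (by positivity)]
    field_simp
  have h1 := h (x + (τ / ‖ζ‖) • ζ) (by rw [hn]; exact hτ1.trans_le (min_le_right _ _))
  have h2 := hg (x + (τ / ‖ζ‖) • ζ) (by rw [hn]; exact hτ1.trans_le (min_le_left _ _))
  rw [hn] at h1 h2
  have h3 : ⟪ζ, x + (τ / ‖ζ‖) • ζ - x⟫ = τ * ‖ζ‖ := by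
    rw [add_sub_cancel_left, real_inner_smul_right, real_inner_self_eq_norm_sq]
    field_simp
  rw [h3] at h1
  nlinarith [mul_pos hτ0 hσ, mul_pos hτ0 (sub_pos.2 hlt)]

/-- A fuzzy sum rule: approximate minimality of `g` over a closed set `C` is decoupled into a
proximal subgradient of `g` and a Fréchet normal of `C` at nearby points. -/
lemma exists_proxSubdiff_frechetNC_of_approx_min [ProperSpace E] {C : Set E} (hC : IsClosed C)
    {g : E → ℝ} {x : E} (hx : x ∈ C) {L ρ c : ℝ} (hL : 0 ≤ L) (hρ : 0 < ρ) (hc : 0 < c)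
    (hg : ∀ a ∈ Metric.closedBall x (2 * ρ), ∀ b ∈ Metric.closedBall x (2 * ρ),
      g a - g b ≤ L * ‖a - b‖)
    (hmin : ∀ p ∈ C, ‖p - x‖ ≤ ρ → g x ≤ g p + c * ‖p - x‖) :
    ∃ w p ζ v, ‖w - x‖ < 2 * ρ ∧ ‖p - x‖ < ρ ∧ p ∈ C ∧ ζ ∈ proxSubdiff g w ∧
      v ∈ frechetNC C p ∧ ‖ζ + v‖ ≤ 4 * c := by
  obtain ⟨n, hn⟩ := exists_gt (max (L ^ 2 / (4 * (c * ρ))) ((c * ρ + 3 * L * ρ) / ρ ^ 2))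
  have hn1 : L ^ 2 < n * (4 * (c * ρ)) := by
    rw [← div_lt_iff₀ (by positivity)]; exact (le_max_left _ _).trans_lt hn
  have hn2 : c * ρ + 3 * L * ρ < n * ρ ^ 2 := by
    rw [← div_lt_iff₀ (by positivity)]; exact (le_max_right _ _).trans_lt hn
  have hn0 : 0 < n := by
    have : (0:ℝ) ≤ L ^ 2 / (4 * (c * ρ)) := by positivity
    exact this.trans_lt ((le_max_left _ _).trans_lt hn)
  have hgc : ContinuousOn g (Metric.closedBall x (2 * ρ)) := by
    refine (LipschitzOnWith.of_dist_le_mul (K := ⟨L, hL⟩) fun a ha b hb => ?_).continuousOn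
    rw [Real.dist_eq, dist_eq_norm, abs_le]
    have h1 := hg a ha b hb
    have h2 := hg b hb a ha
    rw [norm_sub_rev] at h2
    change -(L * ‖a - b‖) ≤ _ ∧ _ ≤ L * ‖a - b‖
    constructor <;> linarith
  obtain ⟨⟨w, p⟩, ⟨hw, hpC, hp⟩, hwp⟩ := IsCompact.exists_isMinOn
    ((isCompact_closedBall x (2 * ρ)).prod ((isCompact_closedBall x ρ).inter_left hC))
    ⟨(x, x), Metric.mem_closedBall_self (by positivity), hx,
      Metric.mem_closedBall_self hρ.le⟩
    (f := fun z : E × E => g z.1 + (2 * c / ρ) * ‖z.2 - x‖ ^ 2 + n * ‖z.1 - z.2‖ ^ 2)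
    (by
      refine ContinuousOn.add (ContinuousOn.add (hgc.comp continuousOn_fst fun z hz => hz.1) ?_) ?_
      · fun_prop
      · fun_prop)
  have hwp' : ∀ w' p', ‖w' - x‖ ≤ 2 * ρ → p' ∈ C → ‖p' - x‖ ≤ ρ →
      g w + (2 * c / ρ) * ‖p - x‖ ^ 2 + n * ‖w - p‖ ^ 2 ≤
      g w' + (2 * c / ρ) * ‖p' - x‖ ^ 2 + n * ‖w' - p'‖ ^ 2 := fun w' p' h1 h2 h3 =>
    hwp (a := (w', p')) ⟨mem_closedBall_iff_norm.2 h1, h2, mem_closedBall_iff_norm.2 h3⟩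
  simp only at hw hp hpC
  have hw' := mem_closedBall_iff_norm.1 hw
  have hp' := mem_closedBall_iff_norm.1 hp
  have hd3 : ‖w - p‖ ≤ 3 * ρ := by
    have := norm_sub_le_norm_sub_add_norm_sub w x p
    rw [norm_sub_rev x p] at this
    linarith
  have hkey : n * ‖w - p‖ ^ 2 + (2 * c / ρ) * ‖p - x‖ ^ 2 ≤ c * ‖p - x‖ + L * ‖w - p‖ := by
    have h1 := hwp' x x (by simp; positivity) hx (by simp; positivity)
    have h2 := hg p (Metric.closedBall_subset_closedBall (by linarith) hp) w hw
    have h3 := hmin p hpC hp'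
    rw [norm_sub_rev] at h2
    simp at h1
    linarith
  have hpx : ‖p - x‖ < ρ := by
    by_contra! hge
    have heq : ‖p - x‖ = ρ := le_antisymm hp' hge
    rw [heq] at hkey
    have h1 : (2 * c / ρ) * ρ ^ 2 = 2 * (c * ρ) := by field_simp
    rw [h1] at hkey
    nlinarith [sq_nonneg (2 * n * ‖w - p‖ - L)]
  have hwp1 : ‖w - p‖ < ρ := by
    have h0 : 0 ≤ (2 * c / ρ) * ‖p - x‖ ^ 2 := by positivity
    have h1 : n * ‖w - p‖ ^ 2 < n * ρ ^ 2 := by nlinarith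
    exact lt_of_pow_lt_pow_left₀ 2 hρ.le (lt_of_mul_lt_mul_left h1 hn0.le)
  have hwx : ‖w - x‖ < 2 * ρ := by
    have := norm_sub_le_norm_sub_add_norm_sub w p x
    linarith
  refine ⟨w, p, -(2 * n) • (w - p), (2 * n) • (w - p) - (4 * c / ρ) • (p - x), hwx, hpx, hpC,
    ⟨n, hn0, 2 * ρ - ‖w - x‖, by linarith, fun y hy => ?_⟩, ?_, ?_⟩
  · have h1 := hwp' y p (by
      have := norm_sub_le_norm_sub_add_norm_sub y w x
      linarith) hpC hp'
    have h2 := norm_add_sq_real (y - w) (w - p)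
    rw [sub_add_sub_cancel] at h2
    rw [real_inner_smul_left]
    rw [real_inner_comm] at h2
    rw [h2] at h1
    linarith
  · refine mem_frechetNC_of_le_sq (σ := 2 * c / ρ + n) (δ := ρ - ‖p - x‖) (by linarith)
      fun y hy hyp => ?_
    have h1 := hwp' w y hw' hy (by
      have := norm_sub_le_norm_sub_add_norm_sub y p x
      linarith)
    have h2 := norm_add_sq_real (y - p) (p - x)
    have h3 := norm_sub_sq_real (w - p) (y - p)
    rw [sub_add_sub_cancel, real_inner_comm] at h2
    rw [sub_sub_sub_cancel_right] at h3
    rw [inner_sub_left, real_inner_smul_left, real_inner_smul_left]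
    rw [h2, h3] at h1
    have h4 : 4 * c / ρ * ⟪p - x, y - p⟫ = 2 * c / ρ * (2 * ⟪p - x, y - p⟫) := by ring
    rw [h4]
    linarith
  · have h1 : -(2 * n) • (w - p) + ((2 * n) • (w - p) - (4 * c / ρ) • (p - x))
        = -((4 * c / ρ) • (p - x)) := by
      rw [neg_smul]; abel
    rw [h1, norm_neg, norm_smul, Real.norm_of_nonneg (by positivity), div_mul_eq_mul_div,
      div_le_iff₀ hρ]
    gcongr

end Hilbert

section Calmness

variable {E F : Type} [NormedAddCommGroup E] [NormedAddCommGroup F]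

/-- If the perturbed constraint map is not calm, there are arbitrarily close infeasible points
of `C` at which the distance from `φ` to `K` is approximately minimal over `C`. -/
lemma exists_approx_min_of_not_calm [ProperSpace E] [ProperSpace F] {φ : E → F} {C : Set E}
    {K : Set F} (hC : IsClosed C) (hK : IsClosed K) {x : E} (hxC : x ∈ C) (hxK : φ x ∈ K)
    {L r : ℝ} (hL : 0 ≤ L) (hr : 0 < r)
    (hφ : ∀ a ∈ Metric.closedBall x r, ∀ b ∈ Metric.closedBall x r,
      ‖φ a - φ b‖ ≤ L * ‖a - b‖)
    (hcalm : ¬ Calm (fun Θ : F => {z : E | z ∈ C ∧ φ z + Θ ∈ K}) 0 x) {ε : ℝ} (hε : 0 < ε) :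
    ∃ w y, w ∈ C ∧ y ∈ K ∧ ‖w - x‖ < ε ∧ ‖w - x‖ < r ∧ ‖y - φ x‖ < ε ∧ φ w - y ≠ 0 ∧
      (∀ y' ∈ K, ‖φ w - y‖ ≤ ‖φ w - y'‖) ∧
      ∃ δ > 0, ∀ w' ∈ C, ‖w' - w‖ < δ → ‖φ w - y‖ ≤ ‖φ w' - y‖ + ε * ‖w' - w‖ := by
  obtain ⟨η, hη, hηr, hηε, hηL⟩ : ∃ η > 0, 2 * η < r ∧ 2 * η < ε ∧ 4 * L * η < ε := by
    refine ⟨min (r / 4) (min (ε / 4) (ε / (4 * L + 1) / 2)), by positivity, ?_, ?_, ?_⟩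
    · have := min_le_left (r / 4) (min (ε / 4) (ε / (4 * L + 1) / 2))
      linarith
    · have := (min_le_right (r / 4) (min (ε / 4) (ε / (4 * L + 1) / 2))).trans (min_le_left _ _)
      linarith
    · have := (min_le_right (r / 4) (min (ε / 4) (ε / (4 * L + 1) / 2))).trans (min_le_right _ _)
      rw [div_div, le_div_iff₀ (by positivity)] at this
      have h0 : 0 < min (r / 4) (min (ε / 4) (ε / ((4 * L + 1) * 2))) := by positivity
      rw [div_div]
      nlinarith
  obtain ⟨Θ, z, hzC, hzK, hzx, hfar⟩ : ∃ Θ z, z ∈ C ∧ φ z + Θ ∈ K ∧ ‖z - x‖ < η ∧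
      ∀ z', z' ∈ C → φ z' ∈ K → ‖Θ‖ < ε * ‖z - z'‖ := by
    by_contra! hcon
    refine hcalm ⟨1 / ε, by positivity, univ, univ_mem, Metric.ball x η,
      Metric.ball_mem_nhds x hη, fun Θ _ z hz => ?_⟩
    obtain ⟨z', h1, h2, h3⟩ := hcon Θ z hz.1.1 hz.1.2 (mem_ball_iff_norm.1 hz.2)
    refine ⟨z', ⟨h1, by simpa using h2⟩, ?_⟩
    rw [sub_zero, one_div_mul_eq_div, le_div_iff₀ hε]
    linarith
  have hne : K.Nonempty := ⟨_, hxK⟩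
  have hφc : ContinuousOn φ (Metric.closedBall x r) := by
    refine (LipschitzOnWith.of_dist_le_mul (K := ⟨L, hL⟩) fun a ha b hb => ?_).continuousOn
    rw [dist_eq_norm, dist_eq_norm]
    exact hφ a ha b hb
  obtain ⟨w, ⟨hwC, hwr⟩, hw⟩ := IsCompact.exists_isMinOn
    ((isCompact_closedBall x r).inter_left hC) ⟨x, hxC, Metric.mem_closedBall_self hr.le⟩
    (f := fun w => Metric.infDist (φ w) K + ε * ‖w - z‖)
    (by
      refine ContinuousOn.add ?_ (by fun_prop)
      exact (Metric.continuous_infDist_pt K).comp_continuousOn (hφc.mono inter_subset_right))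
  have hw' : ∀ w' ∈ C, ‖w' - x‖ ≤ r →
      Metric.infDist (φ w) K + ε * ‖w - z‖ ≤ Metric.infDist (φ w') K + ε * ‖w' - z‖ :=
    fun w' h1 h2 => hw (a := w') ⟨h1, mem_closedBall_iff_norm.2 h2⟩
  have hzd : Metric.infDist (φ z) K ≤ ‖Θ‖ := by
    have := Metric.infDist_le_dist_of_mem (x := φ z) hzK
    rwa [dist_eq_norm, sub_add_cancel_left, norm_neg] at this
  have hwz : ε * ‖w - z‖ ≤ ‖Θ‖ := by
    have h1 := hw' z hzC (by linarith)
    have h2 := Metric.infDist_nonneg (x := φ w) (s := K)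
    simp only [sub_self, norm_zero, mul_zero, add_zero] at h1
    linarith
  have hwzη : ‖w - z‖ < η := by
    have h1 := hfar x hxC hxK
    have h2 : ε * ‖w - z‖ < ε * ‖z - x‖ := by linarith
    exact (lt_of_mul_lt_mul_left h2 hε.le).trans hzx
  have hwx : ‖w - x‖ < 2 * η := by
    have := norm_sub_le_norm_sub_add_norm_sub w z x
    linarith
  obtain ⟨y, hyK, hy⟩ := hK.exists_infDist_eq_dist hne (φ w)
  rw [dist_eq_norm] at hy
  have hnear : ∀ a, ∀ y' ∈ K, Metric.infDist (φ a) K ≤ ‖φ a - y'‖ := fun a y' hy' => by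
    rw [← dist_eq_norm]; exact Metric.infDist_le_dist_of_mem hy'
  refine ⟨w, y, hwC, hyK, by linarith, by linarith, ?_, ?_, fun y' hy' => hy ▸ hnear w y' hy',
    r - ‖w - x‖, by linarith, fun w' hw'C hww => ?_⟩
  · have h1 := hnear w _ hxK
    have h2 := hφ w hwr x (Metric.mem_closedBall_self hr.le)
    have h3 := norm_sub_le_norm_sub_add_norm_sub y (φ w) (φ x)
    rw [norm_sub_rev y (φ w)] at h3
    nlinarith
  · intro h0
    have h1 := hfar w hwC (by rwa [sub_eq_zero.1 h0])
    rw [norm_sub_rev] at h1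
    linarith
  · have h1 := hw' w' hw'C (by
      have := norm_sub_le_norm_sub_add_norm_sub w' w x
      linarith)
    have h2 := hnear w' y hyK
    have h3 := norm_sub_le_norm_sub_add_norm_sub w' w z
    nlinarith

variable [InnerProductSpace ℝ E] [InnerProductSpace ℝ F]

/-- Scalarization: approximate minimality of `‖φ · - y‖` over `C` at `w` yields an approximate
stationarity condition for `⟪lam, φ ·⟫`, for `lam` close to the normalized residual. -/
lemma exists_approx_stationary_of_approx_min [ProperSpace E] {φ : E → F} {C : Set E}
    (hC : IsClosed C) {x w : E} {y : F} {L r ε δ : ℝ} (hL : 0 ≤ L)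
    (hφ : ∀ a ∈ Metric.closedBall x r, ∀ b ∈ Metric.closedBall x r,
      ‖φ a - φ b‖ ≤ L * ‖a - b‖)
    (hε : 0 < ε) (hδ : 0 < δ) (hwC : w ∈ C) (hwr : ‖w - x‖ < r) (hne : φ w - y ≠ 0)
    (hmin : ∀ w' ∈ C, ‖w' - w‖ < δ → ‖φ w - y‖ ≤ ‖φ w' - y‖ + ε * ‖w' - w‖) (lam : F) :
    ∃ w' p ζ v, ‖w' - w‖ < ε ∧ ‖p - w‖ < ε ∧ p ∈ C ∧
      ζ ∈ proxSubdiff (fun a => ⟪lam, φ a⟫) w' ∧ v ∈ frechetNC C p ∧ ‖ζ‖ ≤ ‖lam‖ * L ∧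
      ‖ζ + v‖ ≤ 4 * (2 * ε + L * ‖‖φ w - y‖⁻¹ • (φ w - y) - lam‖) := by
  have ha : 0 < ‖φ w - y‖ := norm_pos_iff.2 hne
  set ν := ‖φ w - y‖⁻¹ • (φ w - y) with hν
  obtain ⟨ρ, hρ, hρε, hρδ, hρr, hρL⟩ : ∃ ρ > 0, 2 * ρ ≤ ε ∧ ρ < δ ∧ 2 * ρ < r - ‖w - x‖ ∧
      L ^ 2 * ρ ≤ ε * (2 * ‖φ w - y‖) := by
    have hr0 : 0 < r - ‖w - x‖ := by linarith
    refine ⟨min (min (ε / 2) (δ / 2))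
      (min ((r - ‖w - x‖) / 4) (ε * (2 * ‖φ w - y‖) / (L ^ 2 + 1))), by positivity, ?_, ?_, ?_, ?_⟩
    · linarith [min_le_left
        (min (ε / 2) (δ / 2)) (min ((r - ‖w - x‖) / 4) (ε * (2 * ‖φ w - y‖) / (L ^ 2 + 1))),
        min_le_left (ε / 2) (δ / 2)]
    · linarith [min_le_left
        (min (ε / 2) (δ / 2)) (min ((r - ‖w - x‖) / 4) (ε * (2 * ‖φ w - y‖) / (L ^ 2 + 1))),
        min_le_right (ε / 2) (δ / 2)]
    · linarith [min_le_right
        (min (ε / 2) (δ / 2)) (min ((r - ‖w - x‖) / 4) (ε * (2 * ‖φ w - y‖) / (L ^ 2 + 1))),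
        min_le_left ((r - ‖w - x‖) / 4) (ε * (2 * ‖φ w - y‖) / (L ^ 2 + 1))]
    · set ρ := min (min (ε / 2) (δ / 2))
        (min ((r - ‖w - x‖) / 4) (ε * (2 * ‖φ w - y‖) / (L ^ 2 + 1)))
      have h1 : ρ ≤ ε * (2 * ‖φ w - y‖) / (L ^ 2 + 1) :=
        (min_le_right _ _).trans (min_le_right _ _)
      have h0 : 0 < ρ := by positivity
      rw [le_div_iff₀ (by positivity)] at h1
      linarith
  have hsub : ∀ a, ‖a - w‖ ≤ 2 * ρ → a ∈ Metric.closedBall x r := fun a h => by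
    rw [mem_closedBall_iff_norm]
    linarith [norm_sub_le_norm_sub_add_norm_sub a w x]
  have hg : ∀ a ∈ Metric.closedBall x r, ∀ b ∈ Metric.closedBall x r,
      ⟪lam, φ a⟫ - ⟪lam, φ b⟫ ≤ ‖lam‖ * L * ‖a - b‖ := fun a ha b hb => by
    rw [← inner_sub_right, mul_assoc]
    exact (real_inner_le_norm _ _).trans
      (mul_le_mul_of_nonneg_left (hφ a ha b hb) (norm_nonneg _))
  obtain ⟨w', p, ζ, v, hw', hp, hpC, hζ, hv, hζv⟩ :=
    exists_proxSubdiff_frechetNC_of_approx_min hC (g := fun a => ⟪lam, φ a⟫) hwC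
      (L := ‖lam‖ * L) (ρ := ρ) (c := 2 * ε + L * ‖ν - lam‖) (by positivity) hρ (by positivity)
      (fun a ha b hb => hg a (hsub a (mem_closedBall_iff_norm.1 ha)) b
        (hsub b (mem_closedBall_iff_norm.1 hb)))
      (fun p hpC hp => by
        have h1 := hmin p hpC (by linarith)
        have h2 := norm_add_le_of_ne_zero hne (φ p - φ w)
        rw [← hν, add_comm (φ w - y), sub_add_sub_cancel] at h2
        have h3 := hφ p (hsub p (by linarith)) w (hsub w (by simp; positivity))
        have h4 : ‖φ p - φ w‖ ^ 2 / (2 * ‖φ w - y‖) ≤ ε * ‖p - w‖ := by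
          rw [div_le_iff₀ (by positivity)]
          have h5 := pow_le_pow_left₀ (norm_nonneg _) h3 2
          have h6 : L ^ 2 * ‖p - w‖ ≤ ε * (2 * ‖φ w - y‖) :=
            (mul_le_mul_of_nonneg_left hp (by positivity)).trans hρL
          nlinarith [norm_nonneg (p - w)]
        have h7 : ⟪ν, φ p - φ w⟫ = ⟪ν - lam, φ p - φ w⟫ + (⟪lam, φ p⟫ - ⟪lam, φ w⟫) := by
          rw [← inner_sub_right, inner_sub_left]; ring
        have h8 : ⟪ν - lam, φ p - φ w⟫ ≤ L * ‖ν - lam‖ * ‖p - w‖ := by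
          have := mul_le_mul_of_nonneg_left h3 (norm_nonneg (ν - lam))
          linarith [real_inner_le_norm (ν - lam) (φ p - φ w)]
        linarith)
  refine ⟨w', p, ζ, v, by linarith, by linarith, hpC, hζ, hv, ?_, hζv⟩
  refine norm_le_of_mem_proxSubdiff hζ (δ := 2 * ρ - ‖w' - w‖) (by linarith) (fun b hb => ?_)
    (by positivity)
  exact hg b (hsub b (by linarith [norm_sub_le_norm_sub_add_norm_sub b w' w])) w'
    (hsub w' hw'.le)

end Calmness

section Product

variable {A B D : Type} [NormedAddCommGroup A] [NormedAddCommGroup B] [NormedAddCommGroup D]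

lemma norm_pl3_zero_zero (b : B) : ‖(pl3 0 b 0 : PL3 A B D)‖ = ‖b‖ := by
  have h : ‖(pl3 0 b 0 : PL3 A B D)‖ ^ 2 = ‖(0 : A)‖ ^ 2 + (‖b‖ ^ 2 + ‖(0 : D)‖ ^ 2) := by
    simp only [WithLp.prod_norm_sq_eq_of_L2]
    rfl
  rw [← sq_eq_sq₀ (norm_nonneg _) (norm_nonneg _), h]
  simp

lemma continuous_pl2fst : Continuous fun z : PL3 A B D => pl2fst z := by
  unfold pl2fst
  simp only [WithLp.equiv_apply]
  fun_prop

lemma continuous_pl2fst_pl2snd : Continuous fun z : PL3 A B D => pl2fst (pl2snd z) := by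
  unfold pl2fst pl2snd
  simp only [WithLp.equiv_apply]
  fun_prop

lemma continuous_pl2snd_pl2snd : Continuous fun z : PL3 A B D => pl2snd (pl2snd z) := by
  unfold pl2snd
  simp only [WithLp.equiv_apply]
  fun_prop

lemma continuous_pl3_zero_zero : Continuous fun b : B => (pl3 0 b 0 : PL3 A B D) := by
  unfold pl3 pl2
  simp only [WithLp.equiv_symm_apply]
  fun_prop

variable [InnerProductSpace ℝ A] [InnerProductSpace ℝ B] [InnerProductSpace ℝ D]

lemma inner_pl3 (v : PL3 A B D) (a : A) (b : B) (d : D) :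
    ⟪v, pl3 a b d⟫ = ⟪pl2fst v, a⟫ + (⟪pl2fst (pl2snd v), b⟫ + ⟪pl2snd (pl2snd v), d⟫) := by
  simp only [WithLp.prod_inner_apply]
  rfl

/-- Fréchet normals of the cylinder `A × U × D` are supported on the middle factor. -/
lemma frechetNC_cylinder {U : Set B} {p v : PL3 A B D} (hp : pl2fst (pl2snd p) ∈ U)
    (hv : v ∈ frechetNC {z : PL3 A B D | pl2fst (pl2snd z) ∈ U} p) :
    pl2fst (pl2snd v) ∈ frechetNC U (pl2fst (pl2snd p)) ∧ v = pl3 0 (pl2fst (pl2snd v)) 0 := by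
  constructor
  · intro ε hε
    obtain ⟨δ, hδ, h⟩ := hv ε hε
    refine ⟨δ, hδ, fun y hy hyp => ?_⟩
    have h1 := h (p + pl3 0 (y - pl2fst (pl2snd p)) 0) (by
      change pl2fst (pl2snd p) + (y - pl2fst (pl2snd p)) ∈ U
      rwa [add_sub_cancel])
    rw [add_sub_cancel_left, norm_pl3_zero_zero, inner_pl3, inner_zero_right, inner_zero_right,
      zero_add, add_zero] at h1
    exact h1 hyp
  · set e : PL3 A B D := pl3 (pl2fst v) 0 (pl2snd (pl2snd v)) with he
    have hve : v = pl3 0 (pl2fst (pl2snd v)) 0 + e := by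
      refine WithLp.ofLp_injective 2 (Prod.ext ?_ (WithLp.ofLp_injective 2 (Prod.ext ?_ ?_)))
      · exact (zero_add _).symm
      · exact (add_zero _).symm
      · exact (zero_add _).symm
    have hinner : ⟪v, e⟫ = ‖e‖ ^ 2 := by
      rw [← real_inner_self_eq_norm_sq]
      conv_rhs => rw [he, inner_pl3]
      conv_lhs => rw [he, inner_pl3]
      rw [inner_zero_right, inner_zero_right]
      rfl
    suffices h0 : e = 0 by rw [h0, add_zero] at hve; exact hve
    by_contra hne
    have hpos : 0 < ‖e‖ := norm_pos_iff.2 hne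
    obtain ⟨δ, hδ, h⟩ := hv (‖e‖ / 2) (by positivity)
    have ht : 0 < δ / 2 / ‖e‖ := by positivity
    have hn : ‖(δ / 2 / ‖e‖) • e‖ = δ / 2 := by
      rw [norm_smul, Real.norm_of_nonneg ht.le]
      field_simp
    have h1 := h (p + (δ / 2 / ‖e‖) • e) (by
      change pl2fst (pl2snd p) + (δ / 2 / ‖e‖) • (0 : B) ∈ U
      rwa [smul_zero, add_zero])
    rw [add_sub_cancel_left, hn, real_inner_smul_right, hinner] at h1
    have h2 := h1 (by linarith)
    have h3 : δ / 2 / ‖e‖ * ‖e‖ ^ 2 = 2 * (‖e‖ / 2 * (δ / 2)) := by field_simp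
    rw [h3] at h2
    have h4 : 0 < ‖e‖ / 2 * (δ / 2) := by positivity
    linarith

end Product

/-- The quasinormality condition at `(x̄,ū,v̄) ∈ M_φ(0)` implies that
the perturbed constraint map `M_φ(Θ) = {(x,u,v) ∈ ℝ^{n_x} × U × ℝ^{n_x} : φ(x,u,v)+Θ ∈ K_φ}`
is calm at `(0,(x̄,ū,v̄))`. -/
theorem quasinormality_implies_calm
    {nx nu m : ℕ}
    (φ : PL3 (Euc nx) (Euc nu) (Euc nx) → Euc m)
    (Uset : Set (Euc nu)) (K : Set (Euc m))
    (hU : IsClosed Uset) (hK : IsClosed K)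
    (xbar : Euc nx) (ubar : Euc nu) (vbar : Euc nx)
    (hφ : ∃ (L : ℝ≥0) (s : Set (PL3 (Euc nx) (Euc nu) (Euc nx))),
        s ∈ 𝓝 (pl3 xbar ubar vbar) ∧ LipschitzOnWith L φ s)
    (hfeas : ubar ∈ Uset ∧ φ (pl3 xbar ubar vbar) ∈ K)
    -- quasinormality at (x̄,ū,v̄):
    (hquasi : ∀ lam : Euc m,
      lam ∈ limitingNC K (φ (pl3 xbar ubar vbar)) →
      -- (0,0,0) ∈ ∂⟨λ,φ⟩(x̄,ū,v̄) + {0} × N_U(ū) × {0}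
      (∃ a ∈ limSubdiff (fun w => ⟪lam, φ w⟫) (pl3 xbar ubar vbar),
        ∃ η ∈ limitingNC Uset ubar, (0 : PL3 (Euc nx) (Euc nu) (Euc nx)) = a + pl3 0 η 0) →
      -- existence of the quasinormality sequence
      (∃ (xs : ℕ → Euc nx) (us : ℕ → Euc nu) (vs : ℕ → Euc nx)
          (ys : ℕ → Euc m) (lams : ℕ → Euc m),
        (∀ k, us k ∈ Uset ∧ ys k ∈ K ∧
          (∀ i : Fin m, lam i ≠ 0 → 0 < lam i * (φ (pl3 (xs k) (us k) (vs k)) i - ys k i))) ∧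
        Tendsto xs atTop (𝓝 xbar) ∧ Tendsto us atTop (𝓝 ubar) ∧
        Tendsto vs atTop (𝓝 vbar) ∧ Tendsto ys atTop (𝓝 (φ (pl3 xbar ubar vbar))) ∧
        Tendsto lams atTop (𝓝 lam)) →
      lam = 0) :
    Calm (fun Θ : Euc m =>
        {z : PL3 (Euc nx) (Euc nu) (Euc nx) | pl2fst (pl2snd z) ∈ Uset ∧ φ z + Θ ∈ K})
      0 (pl3 xbar ubar vbar) := by
  obtain ⟨L, s, hs, hLs⟩ := hφ
  set z := pl3 xbar ubar vbar with hz
  set C : Set (PL3 (Euc nx) (Euc nu) (Euc nx)) := {z | pl2fst (pl2snd z) ∈ Uset} with hCdef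
  have hC : IsClosed C := hU.preimage continuous_pl2fst_pl2snd
  have hzC : z ∈ C := hfeas.1
  obtain ⟨r, hr, hrs⟩ := Metric.nhds_basis_closedBall.mem_iff.1 hs
  have hφL : ∀ a ∈ Metric.closedBall z r, ∀ b ∈ Metric.closedBall z r,
      ‖φ a - φ b‖ ≤ L * ‖a - b‖ := fun a ha b hb => by
    rw [← dist_eq_norm, ← dist_eq_norm]
    exact hLs.dist_le_mul a (hrs ha) b (hrs hb)
  by_contra hcalm
  have hε : ∀ k : ℕ, (0 : ℝ) < 1 / ((k : ℝ) + 1) := fun k => Nat.one_div_pos_of_nat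
  have hε0 := tendsto_one_div_add_atTop_nhds_zero_nat (𝕜 := ℝ)
  choose w y hwC hyK hwz hwr hyz hne hnear δ hδ hmin using fun k : ℕ =>
    exists_approx_min_of_not_calm hC hK hzC hfeas.2 L.2 hr hφL hcalm (hε k)
  have hφz : ContinuousAt φ z := hLs.continuousOn.continuousAt hs
  have hw : Tendsto w atTop (𝓝 z) :=
    tendsto_iff_norm_sub_tendsto_zero.2
      (squeeze_zero (fun _ => norm_nonneg _) (fun k => (hwz k).le) hε0)
  have hy : Tendsto y atTop (𝓝 (φ z)) :=
    tendsto_iff_norm_sub_tendsto_zero.2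
      (squeeze_zero (fun _ => norm_nonneg _) (fun k => (hyz k).le) hε0)
  obtain ⟨lam, hlam, θ, hθ, hν⟩ := (isCompact_sphere (0 : Euc m) 1).tendsto_subseq
    (x := fun k => ‖φ (w k) - y k‖⁻¹ • (φ (w k) - y k)) (fun k => by
      rw [mem_sphere_zero_iff_norm, norm_smul, norm_inv, norm_norm]
      exact inv_mul_cancel₀ (norm_ne_zero_iff.2 (hne k)))
  have hθ' := hθ.tendsto_atTop
  have hlam0 : lam ≠ 0 := by
    rintro rfl
    simp at hlam
  choose w' p ζ v hw' hp hpC hζ hv hζL hζv using fun k : ℕ =>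
    exists_approx_stationary_of_approx_min hC L.2 hφL (hε (θ k)) (hδ (θ k)) (hwC (θ k))
      (hwr (θ k)) (hne (θ k)) (hmin (θ k)) lam
  have hwθ : Tendsto (fun k => w (θ k)) atTop (𝓝 z) := hw.comp hθ'
  have hεθ : Tendsto (fun k => 1 / ((θ k : ℝ) + 1)) atTop (𝓝 0) := hε0.comp hθ'
  have hclose : ∀ q : ℕ → PL3 (Euc nx) (Euc nu) (Euc nx),
      (∀ k, ‖q k - w (θ k)‖ < 1 / ((θ k : ℝ) + 1)) → Tendsto q atTop (𝓝 z) := fun q hq => by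
    have h1 : Tendsto (fun k => q k - w (θ k)) atTop (𝓝 0) :=
      squeeze_zero_norm (fun k => (hq k).le) hεθ
    simpa using h1.add hwθ
  have hw'z := hclose w' hw'
  have hpz := hclose p hp
  obtain ⟨a, -, ψ, hψ, ha⟩ := (isCompact_closedBall (0 : PL3 (Euc nx) (Euc nu) (Euc nx))
    (‖lam‖ * L)).tendsto_subseq (x := ζ) (fun k => by
      rw [mem_closedBall_zero_iff]; exact hζL k)
  have hψ' := hψ.tendsto_atTop
  have hsum : Tendsto (fun k => ζ k + v k) atTop (𝓝 0) := by
    refine squeeze_zero_norm hζv ?_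
    have h1 := ((hεθ.const_mul 2).add
      ((tendsto_iff_norm_sub_tendsto_zero.1 hν).const_mul (L : ℝ))).const_mul 4
    simpa using h1
  have hva : Tendsto (fun k => v (ψ k)) atTop (𝓝 (-a)) := by
    have h1 := (hsum.comp hψ').sub ha
    simpa [Function.comp_def] using h1
  have hcyl := fun k => frechetNC_cylinder (hpC k) (hv k)
  have hη : Tendsto (fun k => pl2fst (pl2snd (v (ψ k)))) atTop (𝓝 (pl2fst (pl2snd (-a)))) :=
    (continuous_pl2fst_pl2snd.tendsto _).comp hva
  have ha_eq : -a = pl3 0 (pl2fst (pl2snd (-a))) 0 := by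
    refine tendsto_nhds_unique hva ?_
    refine ((continuous_pl3_zero_zero.tendsto _).comp hη).congr fun k => ?_
    exact (hcyl (ψ k)).2.symm
  refine hlam0 (hquasi lam ?_ ⟨a, ?_, pl2fst (pl2snd (-a)), ?_, ?_⟩ ?_)
  · exact ⟨fun k => y (θ k), _, fun k => ⟨hyK _, smul_sub_mem_frechetNC_of_nearest
      (hnear (θ k)) (inv_nonneg.2 (norm_nonneg _))⟩, hy.comp hθ', hν⟩
  · refine ⟨fun k => w' (ψ k), fun k => ζ (ψ k), fun k => hζ _, hw'z.comp hψ', ?_, ha⟩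
    exact (((continuous_const.inner continuous_id).tendsto (φ z)).comp hφz).comp
      (hw'z.comp hψ')
  · exact ⟨fun k => pl2fst (pl2snd (p (ψ k))), fun k => pl2fst (pl2snd (v (ψ k))),
      fun k => ⟨hpC _, (hcyl _).1⟩,
      ((continuous_pl2fst_pl2snd.tendsto z).comp hpz).comp hψ', hη⟩
  · rw [← ha_eq, add_neg_cancel]
  · have hsign : ∀ᶠ k in atTop, ∀ i : Fin m, lam i ≠ 0 →
        0 < lam i * (φ (w (θ k)) i - y (θ k) i) := by
      refine eventually_all.2 fun i => ?_
      by_cases hi : lam i = 0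
      · exact Eventually.of_forall fun k h => absurd hi h
      have h1 : Tendsto (fun k => lam i *
          (‖φ (w (θ k)) - y (θ k)‖⁻¹ * (φ (w (θ k)) i - y (θ k) i))) atTop
          (𝓝 (lam i * lam i)) :=
        (((EuclideanSpace.proj (𝕜 := ℝ) i).continuous.tendsto lam).comp hν).const_mul (lam i)
      filter_upwards [h1.eventually_const_lt (mul_self_pos.2 hi)] with k hk _
      rw [mul_left_comm] at hk
      exact pos_of_mul_pos_right hk (inv_nonneg.2 (norm_nonneg _))
    obtain ⟨N, hN⟩ := eventually_atTop.1 hsign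
    have hshift : Tendsto (fun k => w (θ (k + N))) atTop (𝓝 z) :=
      hwθ.comp (tendsto_add_atTop_nat N)
    exact ⟨fun k => pl2fst (w (θ (k + N))), fun k => pl2fst (pl2snd (w (θ (k + N)))),
      fun k => pl2snd (pl2snd (w (θ (k + N)))), fun k => y (θ (k + N)), fun _ => lam,
      fun k => ⟨hwC _, hyK _, hN (k + N) (Nat.le_add_left _ _)⟩,
      (continuous_pl2fst.tendsto z).comp hshift,
      (continuous_pl2fst_pl2snd.tendsto z).comp hshift,
      (continuous_pl2snd_pl2snd.tendsto z).comp hshift,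
      (hy.comp hθ').comp (tendsto_add_atTop_nat N), tendsto_const_nhds⟩

end Stmt15

end
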